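/- Under the closeness-to-diagonal hypotheses, with the choices of Theorem 3.2, for n large enough P(E_{n,ε}) ≥ 1 − exp(−n(−((1+ln(1+v))/v)(m−1) + η²ε²/(2m³D²))), where E_{n,ε} is the event that every optimal cell decomposition has at least (1−ε)d cells whose widths in every coordinate j = 2,...,m lie in [v p_j^(1), v p_j^(2)]. -/

import Mathlib

open MeasureTheory Filter

noncomputable def alignScore {A : Type*} {m n k : ℕ} (S : (Fin m → A) → ℝ)
    (w : Fin m → Fin n → A) (π : Fin m → Fin k → Fin n) : ℝ :=
  ∑ i : Fin k, S (fun j => w j (π j i))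

noncomputable def optScore {A : Type*} (m n : ℕ) (S : (Fin m → A) → ℝ)
    (w : Fin m → Fin n → A) : ℝ :=
  sSup {x : ℝ | ∃ (k : ℕ) (π : Fin m → Fin k → Fin n),
    (∀ j, StrictMono (π j)) ∧ x = alignScore S w π}

def PermInvariant {A : Type*} {m : ℕ} (S : (Fin m → A) → ℝ) : Prop :=
  ∀ (σ : Equiv.Perm (Fin m)) (x : Fin m → A), S (x ∘ σ) = S x

def BddDiffOne {A : Type*} {m : ℕ} (S : (Fin m → A) → ℝ) (D : ℝ) : Prop :=
  ∀ x y : Fin m → A, (∃ j₀, ∀ j, j ≠ j₀ → x j = y j) → |S x - S y| ≤ D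

noncomputable def wordMeasure {A : Type*} [MeasurableSpace A] (p : Measure A) (m n : ℕ) :
    Measure (Fin m → Fin n → A) :=
  Measure.pi fun _ => Measure.pi fun _ => p

noncomputable def expL {A : Type*} [MeasurableSpace A] (p : Measure A) (m n : ℕ)
    (S : (Fin m → A) → ℝ) : ℝ :=
  ∫ w, optScore m n S w ∂(wordMeasure p m n)

noncomputable def optScoreV {A : Type*} (m : ℕ) (ℓ : Fin m → ℕ) (S : (Fin m → A) → ℝ)
    (w : ∀ j : Fin m, Fin (ℓ j) → A) : ℝ :=
  sSup {x : ℝ | ∃ (k : ℕ) (π : ∀ j : Fin m, Fin k → Fin (ℓ j)),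
    (∀ j, StrictMono (π j)) ∧ x = ∑ i : Fin k, S (fun j => w j (π j i))}

noncomputable def wordMeasureV {A : Type*} [MeasurableSpace A] (p : Measure A) {m : ℕ}
    (ℓ : Fin m → ℕ) : Measure (∀ j : Fin m, Fin (ℓ j) → A) :=
  Measure.pi fun _ => Measure.pi fun _ => p

noncomputable def expLV {A : Type*} [MeasurableSpace A] (p : Measure A) {m : ℕ}
    (ℓ : Fin m → ℕ) (S : (Fin m → A) → ℝ) : ℝ :=
  ∫ w, optScoreV m ℓ S w ∂(wordMeasureV p ℓ)

noncomputable def blockScore {A : Type*} {m n : ℕ} (S : (Fin m → A) → ℝ)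
    (w : Fin m → Fin n → A) (lo hi : Fin m → ℕ) : ℝ :=
  sSup {x : ℝ | ∃ (k : ℕ) (π : Fin m → Fin k → Fin n),
    (∀ j, StrictMono (π j)) ∧ (∀ j i, lo j ≤ (π j i : ℕ) ∧ (π j i : ℕ) < hi j) ∧
    x = ∑ i : Fin k, S (fun j => w j (π j i))}

open scoped Classical

def IsDecomp (m n d v : ℕ) (r : Fin m → ℕ → ℕ) : Prop :=
  (∀ j : Fin m, (j : ℕ) = 0 → ∀ k, r j k = v * k) ∧
  ∀ j : Fin m, Monotone (r j) ∧ r j 0 = 0 ∧ r j d = n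

noncomputable def decompScore {A : Type*} {m n : ℕ} (S : (Fin m → A) → ℝ)
    (w : Fin m → Fin n → A) (d : ℕ) (r : Fin m → ℕ → ℕ) : ℝ :=
  ∑ k ∈ Finset.range d, blockScore S w (fun j => r j k) (fun j => r j (k + 1))

def GoodCell (m v : ℕ) (p1 p2 : Fin m → ℝ) (r : Fin m → ℕ → ℕ) (k : ℕ) : Prop :=
  ∀ j : Fin m, (j : ℕ) ≠ 0 →
    (v : ℝ) * p1 j ≤ (r j (k + 1) : ℝ) - (r j k : ℝ) ∧
    (r j (k + 1) : ℝ) - (r j k : ℝ) ≤ (v : ℝ) * p2 j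

section Determ
variable {A : Type*} {m : ℕ}

def ScSet (S : (Fin m → A) → ℝ) (X : Fin m × ℕ → A) (lo hi : Fin m → ℕ) : Set ℝ :=
  {x : ℝ | ∃ (k : ℕ) (π : Fin m → Fin k → ℕ),
    (∀ j, StrictMono (π j)) ∧ (∀ j i, lo j ≤ π j i ∧ π j i < hi j) ∧
    x = ∑ i : Fin k, S (fun j => X (j, π j i))}

noncomputable def sc (S : (Fin m → A) → ℝ) (X : Fin m × ℕ → A) (lo hi : Fin m → ℕ) : ℝ :=
  sSup (ScSet S X lo hi)

lemma scSet_nonempty (S : (Fin m → A) → ℝ) (X : Fin m × ℕ → A) (lo hi : Fin m → ℕ) :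
    (0 : ℝ) ∈ ScSet S X lo hi :=
  ⟨0, fun _ i => i.elim0, fun _ i => i.elim0, fun _ i => i.elim0, by simp⟩

lemma sc_k_le {k lo hi : ℕ} (π : Fin k → ℕ) (h : StrictMono π)
    (hb : ∀ i, lo ≤ π i ∧ π i < hi) : k ≤ hi - lo := by
  have : (Finset.univ.image π) ⊆ Finset.Ico lo hi := by
    intro x hx
    simp only [Finset.mem_image, Finset.mem_univ, true_and] at hx
    obtain ⟨i, rfl⟩ := hx
    simpa using hb i
  have := Finset.card_le_card this
  rw [Finset.card_image_of_injective _ h.injective] at this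
  simpa using this

lemma scSet_bound (S : (Fin m → A) → ℝ) (sStar : ℝ) (hs : 0 ≤ sStar) (hSb : ∀ x, S x ≤ sStar)
    (X : Fin m × ℕ → A) (lo hi : Fin m → ℕ) (j0 : Fin m) :
    ∀ x ∈ ScSet S X lo hi, x ≤ (hi j0 - lo j0 : ℕ) * sStar := by
  rintro x ⟨k, π, h1, h2, rfl⟩
  have hk := sc_k_le (π j0) (h1 j0) (h2 j0)
  calc _ ≤ ∑ i : Fin k, sStar := Finset.sum_le_sum fun i _ => hSb _
    _ = k * sStar := by simp
    _ ≤ _ := by gcongr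

structure SHyp (S : (Fin m → A) → ℝ) (sStar : ℝ) : Prop where
  hm : 0 < m
  pos : ∀ x, 0 ≤ S x
  le : ∀ x, S x ≤ sStar
  s0 : 0 ≤ sStar

lemma SHyp.bdd {S : (Fin m → A) → ℝ} {sStar : ℝ} (h : SHyp S sStar)
    (X : Fin m × ℕ → A) (lo hi : Fin m → ℕ) : BddAbove (ScSet S X lo hi) :=
  ⟨_, scSet_bound S sStar h.s0 h.le X lo hi ⟨0, h.hm⟩⟩

lemma SHyp.sc_nonneg {S : (Fin m → A) → ℝ} {sStar : ℝ} (h : SHyp S sStar)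
    (X : Fin m × ℕ → A) (lo hi : Fin m → ℕ) : 0 ≤ sc S X lo hi :=
  le_csSup (h.bdd X lo hi) (scSet_nonempty S X lo hi)

lemma SHyp.sc_le {S : (Fin m → A) → ℝ} {sStar : ℝ} (h : SHyp S sStar)
    (X : Fin m × ℕ → A) (lo hi : Fin m → ℕ) (j0 : Fin m) :
    sc S X lo hi ≤ (hi j0 - lo j0 : ℕ) * sStar :=
  csSup_le ⟨_, scSet_nonempty S X lo hi⟩ (scSet_bound S sStar h.s0 h.le X lo hi j0)

lemma SHyp.sc_add {S : (Fin m → A) → ℝ} {sStar : ℝ} (h : SHyp S sStar)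
    (X : Fin m × ℕ → A) (a b c : Fin m → ℕ) (hab : ∀ j, a j ≤ b j) (hbc : ∀ j, b j ≤ c j) :
    sc S X a b + sc S X b c ≤ sc S X a c := by
  have key : ∀ x ∈ ScSet S X a b, ∀ y ∈ ScSet S X b c, x + y ≤ sc S X a c := by
    rintro x ⟨k, π, h1, h2, rfl⟩ y ⟨l, ρ, h3, h4, rfl⟩
    apply le_csSup (h.bdd X a c)
    refine ⟨k + l, fun j => Fin.append (π j) (ρ j), ?_, ?_, ?_⟩
    · intro j i i'
      refine Fin.addCases (fun i => ?_) (fun i => ?_) i <;>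
        refine Fin.addCases (fun i' => ?_) (fun i' => ?_) i' <;> intro hii
      · simp only [Fin.append_left]
        exact h1 j (by rw [Fin.lt_def] at hii ⊢; simp only [Fin.val_castAdd] at hii; exact hii)
      · simp only [Fin.append_left, Fin.append_right]
        exact lt_of_lt_of_le (h2 j i).2 (h4 j i').1
      · rw [Fin.lt_def] at hii; simp only [Fin.val_natAdd, Fin.val_castAdd] at hii
        have := i'.2
        omega
      · simp only [Fin.append_right]
        exact h3 j (by rw [Fin.lt_def] at hii ⊢; simp only [Fin.val_natAdd] at hii; omega)
    · intro j i
      refine Fin.addCases (fun i => ?_) (fun i => ?_) i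
      · simp only [Fin.append_left]
        exact ⟨(h2 j i).1, (h2 j i).2.trans_le (hbc j)⟩
      · simp only [Fin.append_right]
        exact ⟨(hab j).trans (h4 j i).1, (h4 j i).2⟩
    · rw [Fin.sum_univ_add]
      simp
  have h1 : ∀ y ∈ ScSet S X b c, sc S X a b + y ≤ sc S X a c := by
    intro y hy
    have : sc S X a b ≤ sc S X a c - y :=
      csSup_le ⟨_, scSet_nonempty S X a b⟩ fun x hx => by linarith [key x hx y hy]
    linarith
  have : sc S X b c ≤ sc S X a c - sc S X a b :=
    csSup_le ⟨_, scSet_nonempty S X b c⟩ fun y hy => by linarith [h1 y hy]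
  linarith

lemma SHyp.sc_sum {S : (Fin m → A) → ℝ} {sStar : ℝ} (h : SHyp S sStar)
    (X : Fin m × ℕ → A) (r : Fin m → ℕ → ℕ) (hr : ∀ j, Monotone (r j)) (d : ℕ) :
    ∑ k ∈ Finset.range d, sc S X (fun j => r j k) (fun j => r j (k + 1)) ≤
      sc S X (fun j => r j 0) (fun j => r j d) := by
  induction d with
  | zero => simpa using h.sc_nonneg X _ _
  | succ d ih =>
    rw [Finset.sum_range_succ]
    have := h.sc_add X (fun j => r j 0) (fun j => r j d) (fun j => r j (d + 1))
      (fun j => hr j (Nat.zero_le _)) (fun j => hr j (Nat.le_succ _))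
    linarith

lemma SHyp.sc_diff {S : (Fin m → A) → ℝ} {sStar D : ℝ} (h : SHyp S sStar) (hD : 0 ≤ D)
    (hBD : BddDiffOne S D) (X X' : Fin m × ℕ → A) (j0 : Fin m) (i0 : ℕ)
    (hX : ∀ q, q ≠ (j0, i0) → X q = X' q) (lo hi : Fin m → ℕ) :
    sc S X lo hi ≤ sc S X' lo hi + (if lo j0 ≤ i0 ∧ i0 < hi j0 then D else 0) := by
  apply csSup_le ⟨_, scSet_nonempty S X lo hi⟩
  rintro x ⟨k, π, h1, h2, rfl⟩
  have h3 : ∑ i : Fin k, S (fun j => X' (j, π j i)) ≤ sc S X' lo hi :=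
    le_csSup (h.bdd X' lo hi) ⟨k, π, h1, h2, rfl⟩
  have h4 : ∀ i : Fin k, S (fun j => X (j, π j i)) ≤ S (fun j => X' (j, π j i)) +
      (if π j0 i = i0 then D else 0) := by
    intro i
    split_ifs with hi
    · have := hBD (fun j => X (j, π j i)) (fun j => X' (j, π j i)) ⟨j0, fun j hj => hX _ (by
        intro hh; exact hj (Prod.mk.inj hh).1)⟩
      have := (abs_le.1 this).2
      linarith
    · have : (fun j => X (j, π j i)) = (fun j => X' (j, π j i)) := by
        funext j
        apply hX
        intro hh
        obtain ⟨h6, h7⟩ := Prod.mk.inj hh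
        subst h6
        exact hi h7
      rw [this]; simp
  have h5 : ∑ i : Fin k, (if π j0 i = i0 then D else 0) ≤
      (if lo j0 ≤ i0 ∧ i0 < hi j0 then D else 0) := by
    by_cases hex : ∃ i, π j0 i = i0
    · obtain ⟨i, rfl⟩ := hex
      rw [if_pos (h2 j0 i)]
      simp only [(h1 j0).injective.eq_iff]
      simp
    · push Not at hex
      simp only [hex, if_false, Finset.sum_const_zero]
      split_ifs <;> simp [hD]
  calc _ ≤ ∑ i : Fin k, (S (fun j => X' (j, π j i)) + (if π j0 i = i0 then D else 0)) :=
        Finset.sum_le_sum fun i _ => h4 i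
    _ ≤ _ := by rw [Finset.sum_add_distrib]; linarith

lemma ind_sum (r : ℕ → ℕ) (hr : Monotone r) (i0 d : ℕ) (D : ℝ) :
    ∑ k ∈ Finset.range d, (if r k ≤ i0 ∧ i0 < r (k + 1) then D else 0) =
      if r 0 ≤ i0 ∧ i0 < r d then D else 0 := by
  induction d with
  | zero =>
    rw [if_neg (by omega)]; simp
  | succ d ih =>
    rw [Finset.sum_range_succ, ih]
    have h1 := hr (Nat.zero_le d)
    have h2 := hr (Nat.le_succ d)
    by_cases a : r 0 ≤ i0 <;> by_cases b : i0 < r d <;> by_cases c : i0 < r (d + 1) <;>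
      by_cases e : r d ≤ i0 <;> simp [a, b, c, e] <;> simp at * <;> omega

lemma SHyp.sc_sum_diff {S : (Fin m → A) → ℝ} {sStar D : ℝ} (h : SHyp S sStar) (hD : 0 ≤ D)
    (hBD : BddDiffOne S D) (X X' : Fin m × ℕ → A) (j0 : Fin m) (i0 : ℕ)
    (hX : ∀ q, q ≠ (j0, i0) → X q = X' q) (r : Fin m → ℕ → ℕ) (hr : ∀ j, Monotone (r j)) (d : ℕ) :
    ∑ k ∈ Finset.range d, sc S X (fun j => r j k) (fun j => r j (k + 1)) ≤
    ∑ k ∈ Finset.range d, sc S X' (fun j => r j k) (fun j => r j (k + 1)) + D := by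
  calc _ ≤ ∑ k ∈ Finset.range d, (sc S X' (fun j => r j k) (fun j => r j (k + 1)) +
        (if r j0 k ≤ i0 ∧ i0 < r j0 (k + 1) then D else 0)) :=
        Finset.sum_le_sum fun k _ => h.sc_diff hD hBD X X' j0 i0 hX _ _
    _ ≤ _ := by
      rw [Finset.sum_add_distrib, ind_sum (r j0) (hr j0)]
      split_ifs <;> linarith

/-- Bridge for blocks, with a permutation of the coordinates. -/
lemma optScoreV_eq_sc (S : (Fin m → A) → ℝ) (hSperm : PermInvariant S)
    (X : Fin m × ℕ → A) (σ : Equiv.Perm (Fin m)) (lo hi ℓ : Fin m → ℕ)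
    (hh : ∀ j, hi (σ j) = lo (σ j) + ℓ j) :
    optScoreV m ℓ S (fun j i => X (σ j, lo (σ j) + i)) = sc S X lo hi := by
  unfold optScoreV sc
  congr 1
  ext x
  constructor
  · rintro ⟨k, π, h1, rfl⟩
    refine ⟨k, fun j i => lo j + π (σ.symm j) i, ?_, ?_, ?_⟩
    · intro j a b hab
      have := h1 (σ.symm j) hab
      simpa using this
    · intro j i
      have := (π (σ.symm j) i).2
      have h3 := hh (σ.symm j)
      simp only [Equiv.apply_symm_apply] at h3
      show lo j ≤ lo j + (π (σ.symm j) i : ℕ) ∧ lo j + (π (σ.symm j) i : ℕ) < hi j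
      omega
    · refine Finset.sum_congr rfl fun i _ => ?_
      rw [← hSperm σ (fun j => X (j, lo j + (π (σ.symm j) i : ℕ)))]
      congr 1
      funext j
      simp only [Function.comp]
      rw [Equiv.symm_apply_apply]
  · rintro ⟨k, π, h1, h2, rfl⟩
    refine ⟨k, fun j i => ⟨π (σ j) i - lo (σ j), ?_⟩, ?_, ?_⟩
    · have := h2 (σ j) i
      have := hh j
      omega
    · intro j a b hab
      have := h1 (σ j) hab
      have h3 := h2 (σ j) a
      have h4 := h2 (σ j) b
      simp only [Fin.lt_def]
      omega
    · refine Finset.sum_congr rfl fun i _ => ?_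
      rw [← hSperm σ]
      congr 1
      funext j
      simp only [Function.comp]
      have h3 := h2 (σ j) i
      congr 2
      omega

lemma optScore_eq_V {n : ℕ} (S : (Fin m → A) → ℝ) (w : Fin m → Fin n → A) :
    optScore m n S w = optScoreV m (fun _ => n) S w := rfl

lemma expL_eq_V [MeasurableSpace A] (p : Measure A) (n : ℕ) (S : (Fin m → A) → ℝ) :
    expL p m n S = expLV p (fun _ : Fin m => n) S := rfl

lemma blockScore_eq_sc {n : ℕ} (S : (Fin m → A) → ℝ) (X : Fin m × ℕ → A)
    (w : Fin m → Fin n → A) (hw : ∀ j i, w j i = X (j, i)) (lo hi : Fin m → ℕ)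
    (hh : ∀ j, hi j ≤ n) : blockScore S w lo hi = sc S X lo hi := by
  unfold blockScore sc
  congr 1
  ext x
  constructor
  · rintro ⟨k, π, h1, h2, rfl⟩
    refine ⟨k, fun j i => π j i, fun j a b hab => h1 j hab, h2, ?_⟩
    simp [hw]
  · rintro ⟨k, π, h1, h2, rfl⟩
    refine ⟨k, fun j i => ⟨π j i, (h2 j i).2.trans_le (hh j)⟩, fun j a b hab => h1 j hab,
      fun j i => h2 j i, ?_⟩
    simp [hw]

lemma optScore_eq_sc {n : ℕ} (S : (Fin m → A) → ℝ) (X : Fin m × ℕ → A)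
    (w : Fin m → Fin n → A) (hw : ∀ j i, w j i = X (j, i)) :
    optScore m n S w = sc S X (fun _ => 0) (fun _ => n) := by
  rw [← blockScore_eq_sc S X w hw _ _ (fun _ => le_rfl)]
  unfold optScore blockScore
  congr 1
  ext x
  simp [alignScore]

end Determ
section Proba
open ProbabilityTheory
variable {A : Type*} [MeasurableSpace A]

lemma map_wordMeasureV (p : Measure A) [IsProbabilityMeasure p] {m : ℕ} (ℓ : Fin m → ℕ)
    {κ : Type*} (φ : (j : Fin m) → Fin (ℓ j) → κ)
    (hφ : Function.Injective (fun s : (Σ j, Fin (ℓ j)) => φ s.1 s.2)) :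
    MeasurePreserving (fun (x : κ → A) (j : Fin m) (i : Fin (ℓ j)) => x (φ j i))
      (Measure.infinitePi fun _ : κ => p) (wordMeasureV p ℓ) := by
  refine ⟨by fun_prop, ?_⟩
  have h1 := Measure.map_infinitePi_infinitePi_of_inj (P := fun _ : κ => p) hφ
  have h2 := Measure.infinitePi_map_piCurry (fun (j : Fin m) (_ : Fin (ℓ j)) => p)
  unfold wordMeasureV
  rw [← h1, Measure.map_map (by fun_prop) (by fun_prop)] at h2
  simp only [Measure.infinitePi_eq_pi] at h2
  exact h2

/-- McDiarmid, exponential moment form. -/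
lemma mcd_mgf [Finite A] [DiscreteMeasurableSpace A] (p : Measure A) [IsProbabilityMeasure p]
    (c : ℝ) (hc : 0 ≤ c) (t : ℝ) (N : ℕ) : ∀ (f : (Fin N → A) → ℝ)
    (_ : ∀ x y i, (∀ i', i' ≠ i → x i' = y i') → f x ≤ f y + c),
    ∫ x, Real.exp (t * (f x - ∫ y, f y ∂(Measure.pi fun _ => p))) ∂(Measure.pi fun _ => p) ≤
      Real.exp (N * (c ^ 2 * t ^ 2 / 8)) := by
  have : Nonempty A := nonempty_of_isProbabilityMeasure p
  induction N with
  | zero =>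
    intro f hf
    have : ∀ x, f x = f default := fun x => congrArg f (Subsingleton.elim _ _)
    simp [this]
  | succ N ih =>
    intro f hf
    have hmp := (measurePreserving_piFinSuccAbove (fun _ : Fin (N + 1) => p) 0).symm
    have hcons : ∀ (F : (Fin (N + 1) → A) → ℝ), ∫ x, F x ∂(Measure.pi fun _ => p) =
        ∫ y, ∫ a, F (Fin.cons a y) ∂p ∂(Measure.pi fun _ : Fin N => p) := by
      intro F
      rw [← hmp.integral_comp' (g := F), integral_prod_symm _ (Integrable.of_finite)]
      simp [MeasurableEquiv.piFinSuccAbove, Fin.insertNthEquiv]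
    set g : (Fin N → A) → ℝ := fun y => ∫ a, f (Fin.cons a y) ∂p with hg
    have hgE : ∫ x, f x ∂(Measure.pi fun _ => p) = ∫ y, g y ∂(Measure.pi fun _ : Fin N => p) :=
      hcons f
    have hgd : ∀ x y i, (∀ i', i' ≠ i → x i' = y i') → g x ≤ g y + c := by
      intro x y i hxy
      have : ∫ a, f (Fin.cons a x) ∂p ≤ ∫ a, (f (Fin.cons a y) + c) ∂p := by
        apply integral_mono Integrable.of_finite Integrable.of_finite
        intro a
        apply hf _ _ i.succ
        intro i' hi'
        refine Fin.cases ?_ (fun k => ?_) i' hi'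
        · intro _; simp
        · intro hk
          simp only [Fin.cons_succ]
          exact hxy k (fun h => hk (by rw [h]))
      rw [integral_add Integrable.of_finite Integrable.of_finite] at this
      simpa [hg] using this
    have hin : ∀ y : Fin N → A, ∫ a, Real.exp (t * (f (Fin.cons a y) - g y)) ∂p ≤
        Real.exp (c ^ 2 * t ^ 2 / 8) := by
      intro y
      have hfin : (Set.range fun a => f (Fin.cons a y)).Finite := Set.finite_range _
      obtain ⟨a0, ha0⟩ := Finite.exists_min (fun a => f (Fin.cons a y))
      have hb : ∀ a, f (Fin.cons a y) ∈ Set.Icc (f (Fin.cons a0 y)) (f (Fin.cons a0 y) + c) := by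
        intro a
        refine ⟨ha0 a, hf _ _ 0 ?_⟩
        intro i' hi'
        obtain ⟨k, rfl⟩ := Fin.exists_succ_eq.2 hi'
        simp
      have := (hasSubgaussianMGF_of_mem_Icc (μ := p) (X := fun a => f (Fin.cons a y))
        (Measurable.of_discrete.aemeasurable) (Filter.Eventually.of_forall hb)).mgf_le t
      rw [mgf] at this
      refine this.trans (le_of_eq ?_)
      congr 1
      simp [abs_of_nonneg hc]
      ring
    rw [hcons, hgE]
    calc ∫ y, ∫ a, Real.exp (t * (f (Fin.cons a y) - ∫ y, g y ∂(Measure.pi fun _ : Fin N => p))) ∂p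
          ∂(Measure.pi fun _ : Fin N => p)
        = ∫ y, Real.exp (t * (g y - ∫ y, g y ∂(Measure.pi fun _ : Fin N => p))) *
          ∫ a, Real.exp (t * (f (Fin.cons a y) - g y)) ∂p ∂(Measure.pi fun _ : Fin N => p) := by
          congr 1
          funext y
          rw [← integral_const_mul]
          congr 1
          funext a
          rw [← Real.exp_add]
          congr 1
          ring
      _ ≤ ∫ y, Real.exp (t * (g y - ∫ y, g y ∂(Measure.pi fun _ : Fin N => p))) *
          Real.exp (c ^ 2 * t ^ 2 / 8) ∂(Measure.pi fun _ : Fin N => p) := by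
          apply integral_mono Integrable.of_finite Integrable.of_finite
          intro y
          exact mul_le_mul_of_nonneg_left (hin y) (Real.exp_nonneg _)
      _ ≤ Real.exp (N * (c ^ 2 * t ^ 2 / 8)) * Real.exp (c ^ 2 * t ^ 2 / 8) := by
          rw [integral_mul_const]
          exact mul_le_mul_of_nonneg_right (ih g hgd) (Real.exp_nonneg _)
      _ = _ := by
          rw [← Real.exp_add]
          congr 1
          push_cast
          ring

lemma mcd [Finite A] [DiscreteMeasurableSpace A] (p : Measure A) [IsProbabilityMeasure p]
    (c : ℝ) (hc : 0 < c) (s : ℝ) (hs : 0 ≤ s) (N : ℕ) (hN : 0 < N) (f : (Fin N → A) → ℝ)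
    (hf : ∀ x y i, (∀ i', i' ≠ i → x i' = y i') → f x ≤ f y + c)
    (hE : ∫ y, f y ∂(Measure.pi fun _ => p) ≤ -s) :
    (Measure.pi fun _ : Fin N => p).real {x | 0 ≤ f x} ≤ Real.exp (- (2 * s ^ 2 / (N * c ^ 2))) := by
  set t : ℝ := 4 * s / (N * c ^ 2) with ht
  have hN' : (0 : ℝ) < N := by exact_mod_cast hN
  have ht0 : 0 ≤ t := by positivity
  have h1 := mcd_mgf p c hc.le t N f hf
  set E := ∫ y, f y ∂(Measure.pi fun _ : Fin N => p) with hEdef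
  have h2 := measure_ge_le_exp_mul_mgf (μ := Measure.pi fun _ : Fin N => p)
    (X := fun x => f x - E) (t := t) s ht0 Integrable.of_finite
  have h3 : (Measure.pi fun _ : Fin N => p).real {x | 0 ≤ f x} ≤
      (Measure.pi fun _ : Fin N => p).real {x | s ≤ f x - E} := by
    apply measureReal_mono
    · intro x hx
      simp only [Set.mem_ofPred_eq] at hx ⊢
      linarith
    · exact measure_ne_top _ _
  refine h3.trans (h2.trans ?_)
  rw [mgf]
  refine (mul_le_mul_of_nonneg_left h1 (Real.exp_nonneg _)).trans ?_
  rw [← Real.exp_add]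
  apply Real.exp_le_exp.2
  apply le_of_eq
  rw [ht]
  field_simp
  ring

/-- McDiarmid on words. -/
lemma mcd_word [Finite A] [DiscreteMeasurableSpace A] (p : Measure A) [IsProbabilityMeasure p]
    (m n : ℕ) (hmn : 0 < m * n)
    (c : ℝ) (hc : 0 < c) (s : ℝ) (hs : 0 ≤ s) (f : (Fin m → Fin n → A) → ℝ)
    (hf : ∀ x y j i, (∀ j' i', (j', i') ≠ (j, i) → x j' i' = y j' i') → f x ≤ f y + c)
    (hE : ∫ y, f y ∂(wordMeasure p m n) ≤ -s) :
    (wordMeasure p m n).real {x | 0 ≤ f x} ≤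
      Real.exp (- (2 * s ^ 2 / ((m * n : ℕ) * c ^ 2))) := by
  have hmp := map_wordMeasureV p (fun _ : Fin m => n) (κ := Fin (m * n))
    (fun j i => finProdFinEquiv (j, i)) (by
      rintro ⟨a, b⟩ ⟨a', b'⟩ h
      have := finProdFinEquiv.injective h
      simpa using this)
  rw [Measure.infinitePi_eq_pi] at hmp
  have e : wordMeasureV p (fun _ : Fin m => n) = wordMeasure p m n := rfl
  rw [e] at hmp
  have h1 := mcd p c hc s hs (m * n) hmn (fun x => f (fun j i => x (finProdFinEquiv (j, i)))) (by
    intro x y i hxy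
    apply hf _ _ (finProdFinEquiv.symm i).1 (finProdFinEquiv.symm i).2
    intro j' i' hne
    apply hxy
    rintro rfl
    simp at hne) (by
      rw [← hmp.map_eq, integral_map hmp.measurable.aemeasurable
        Measurable.of_discrete.aestronglyMeasurable] at hE
      exact hE)
  refine le_trans (le_of_eq ?_) h1
  rw [measureReal_def, ← hmp.measure_preimage (MeasurableSet.of_discrete).nullMeasurableSet]
  rfl

end Proba
section Expect
open ProbabilityTheory
variable {A : Type*} [MeasurableSpace A] [Finite A] [DiscreteMeasurableSpace A]

lemma E_sc (p : Measure A) [IsProbabilityMeasure p] {m : ℕ} (S : (Fin m → A) → ℝ)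
    (hSperm : PermInvariant S) (σ : Equiv.Perm (Fin m)) (lo hi ℓ : Fin m → ℕ)
    (hh : ∀ j, hi (σ j) = lo (σ j) + ℓ j) :
    Integrable (fun X => sc S X lo hi) (Measure.infinitePi fun _ : Fin m × ℕ => p) ∧
    ∫ X, sc S X lo hi ∂(Measure.infinitePi fun _ : Fin m × ℕ => p) = expLV p ℓ S := by
  have hmp := map_wordMeasureV p ℓ (κ := Fin m × ℕ) (fun j i => (σ j, lo (σ j) + i)) (by
    rintro ⟨a, b⟩ ⟨a', b'⟩ h
    simp only [Prod.mk.injEq, EmbeddingLike.apply_eq_iff_eq] at h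
    obtain ⟨h1, h2⟩ := h
    subst h1
    have : b = b' := by ext; omega
    rw [this])
  have e : (fun X => sc S X lo hi) = (optScoreV m ℓ S) ∘
      (fun (x : Fin m × ℕ → A) (j : Fin m) (i : Fin (ℓ j)) => x (σ j, lo (σ j) + i)) := by
    funext X
    exact (optScoreV_eq_sc S hSperm X σ lo hi ℓ hh).symm
  have : IsProbabilityMeasure (wordMeasureV p ℓ) := by unfold wordMeasureV; infer_instance
  constructor
  · rw [e]
    exact hmp.integrable_comp_of_integrable Integrable.of_finite
  · rw [e]
    unfold expLV
    rw [← hmp.map_eq, integral_map hmp.measurable.aemeasurable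
        Measurable.of_discrete.aestronglyMeasurable]
    rfl

lemma E_sc' (p : Measure A) [IsProbabilityMeasure p] {m : ℕ} (S : (Fin m → A) → ℝ)
    (hSperm : PermInvariant S) (lo hi : Fin m → ℕ) (hh : ∀ j, lo j ≤ hi j) :
    Integrable (fun X => sc S X lo hi) (Measure.infinitePi fun _ : Fin m × ℕ => p) ∧
    ∫ X, sc S X lo hi ∂(Measure.infinitePi fun _ : Fin m × ℕ => p) =
      expLV p (fun j => hi j - lo j) S :=
  E_sc p S hSperm (Equiv.refl _) lo hi _ (fun j => by have := hh j; simp; omega)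

/-- Superadditivity in expectation, with permuted cells. -/
lemma E_super (p : Measure A) [IsProbabilityMeasure p] {m : ℕ} {S : (Fin m → A) → ℝ}
    {sStar : ℝ} (h : SHyp S sStar)
    (hSperm : PermInvariant S) (r : Fin m → ℕ → ℕ) (hr : ∀ j, Monotone (r j)) (h0 : ∀ j, r j 0 = 0)
    (d : ℕ) (σ : ℕ → Equiv.Perm (Fin m)) (ℓ : Fin m → ℕ)
    (hh : ∀ k < d, ∀ j, r (σ k j) (k + 1) = r (σ k j) k + ℓ j) :
    d * expLV p ℓ S ≤ expLV p (fun j => r j d) S := by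
  have h1 : ∀ k ∈ Finset.range d, Integrable
      (fun X => sc S X (fun j => r j k) (fun j => r j (k + 1)))
      (Measure.infinitePi fun _ : Fin m × ℕ => p) := fun k hk =>
    (E_sc p S hSperm (σ k) _ _ ℓ (fun j => hh k (Finset.mem_range.1 hk) j)).1
  have h2 := E_sc' p S hSperm (fun j => r j 0) (fun j => r j d) (fun j => hr j (Nat.zero_le _))
  have h3 := integral_mono (integrable_finsetSum _ h1) h2.1
    (fun X => h.sc_sum X r hr d)
  rw [integral_finsetSum _ h1, h2.2] at h3
  simp only [h0, Nat.sub_zero] at h3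
  refine le_trans (le_of_eq ?_) h3
  rw [Finset.sum_congr rfl (fun k hk =>
    (E_sc p S hSperm (σ k) (fun j => r j k) (fun j => r j (k + 1)) ℓ
      (fun j => hh k (Finset.mem_range.1 hk) j)).2)]
  simp

lemma E_mul (p : Measure A) [IsProbabilityMeasure p] {m : ℕ} {S : (Fin m → A) → ℝ}
    {sStar : ℝ} (h : SHyp S sStar) (hSperm : PermInvariant S) (ℓ : Fin m → ℕ) (k : ℕ) :
    k * expLV p ℓ S ≤ expLV p (fun j => k * ℓ j) S := by
  exact E_super p h hSperm (fun j i => i * ℓ j)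
    (fun j a b hab => Nat.mul_le_mul_right _ hab) (fun j => by simp) k (fun _ => Equiv.refl _) ℓ
    (fun k _ j => by simp; ring)

lemma E_cyc (p : Measure A) [IsProbabilityMeasure p] {m : ℕ} {S : (Fin m → A) → ℝ}
    {sStar : ℝ} (h : SHyp S sStar) (hSperm : PermInvariant S) (ℓ : Fin m → ℕ) :
    m * expLV p ℓ S ≤ expL p m (∑ j, ℓ j) S := by
  have : NeZero m := ⟨h.hm.ne'⟩
  have h1 := E_super p h hSperm (fun j k => ∑ s ∈ Finset.range k, ℓ (j + Fin.ofNat m s))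
    (fun j a b hab => Finset.sum_le_sum_of_subset (by simpa using hab))
    (fun j => by simp) m (fun k => Equiv.subRight (Fin.ofNat m k)) ℓ
    (fun k _ j => by
      rw [Finset.sum_range_succ]
      simp)
  rw [expL_eq_V]
  convert h1 using 3 with j
  rw [Finset.sum_range]
  rw [← Equiv.sum_comp (Equiv.addLeft j)]
  refine Finset.sum_congr rfl fun s _ => ?_
  simp

lemma expL_le (p : Measure A) [IsProbabilityMeasure p] {m : ℕ} {S : (Fin m → A) → ℝ}
    {sStar : ℝ} (h : SHyp S sStar) (hSperm : PermInvariant S) (γ : ℝ)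
    (hγ : Tendsto (fun n : ℕ => expL p m n S / n) atTop (nhds γ)) (n : ℕ) (hn : 0 < n) :
    expL p m n S ≤ γ * n := by
  have h1 : Tendsto (fun k : ℕ => k * n) atTop atTop :=
    tendsto_id.atTop_mul_const' hn
  have h2 := ((hγ.comp h1).mul_const (n : ℝ))
  refine ge_of_tendsto h2 ?_
  filter_upwards [eventually_gt_atTop 0] with k hk
  have h3 := E_mul p h hSperm (fun _ => n) k
  rw [← expL_eq_V, ← expL_eq_V] at h3
  have hk' : (0 : ℝ) < k := by exact_mod_cast hk
  have hn' : (0 : ℝ) < n := by exact_mod_cast hn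
  simp only [Function.comp, Nat.cast_mul]
  rw [div_mul_eq_mul_div, le_div_iff₀ (by positivity)]
  nlinarith

lemma cell_le (p : Measure A) [IsProbabilityMeasure p] {m : ℕ} {S : (Fin m → A) → ℝ}
    {sStar : ℝ} (h : SHyp S sStar) (hSperm : PermInvariant S) (γ : ℝ)
    (hγ : Tendsto (fun n : ℕ => expL p m n S / n) atTop (nhds γ)) (ℓ : Fin m → ℕ)
    (hl : 0 < ∑ j, ℓ j) :
    expLV p ℓ S ≤ γ * ((∑ j, ℓ j : ℕ) / m) := by
  have h1 := (E_cyc p h hSperm ℓ).trans (expL_le p h hSperm γ hγ _ hl)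
  have : (0 : ℝ) < m := by exact_mod_cast h.hm
  rw [← mul_div_assoc, le_div_iff₀ this]
  linarith

lemma bad_cell_le (p : Measure A) [IsProbabilityMeasure p] {m : ℕ} {S : (Fin m → A) → ℝ}
    {sStar : ℝ} (h : SHyp S sStar) (hSperm : PermInvariant S) (δStar : ℝ)
    (g : (Fin m → ℝ) → ℝ)
    (hg : ∀ q : Fin m → ℝ, (∀ j, 0 < q j) → q ⟨0, h.hm⟩ = 1 →
      Tendsto (fun n : ℕ => expLV p (fun j => ⌈(n : ℝ) * q j⌉₊) S /
        ((n : ℝ) * (∑ j, q j) / m)) atTop (nhds (g q)))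
    (p1 p2 : Fin m → ℝ)
    (hoff : ∀ q : Fin m → ℝ, (∀ j, 0 < q j) → q ⟨0, h.hm⟩ = 1 →
      (∃ j : Fin m, (j : ℕ) ≠ 0 ∧ (q j < p1 j ∨ p2 j < q j)) → g q ≤ δStar)
    (hδ : 0 < δStar) (v : ℕ) (hv : 0 < v) (ℓ : Fin m → ℕ) (h0 : ℓ ⟨0, h.hm⟩ = v)
    (hbad : ∃ j : Fin m, (j : ℕ) ≠ 0 ∧ ((ℓ j : ℝ) < v * p1 j ∨ v * p2 j < (ℓ j : ℝ))) :
    expLV p ℓ S ≤ δStar * ((∑ j, ℓ j : ℕ) / m) := by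
  have hv' : (0 : ℝ) < v := by exact_mod_cast hv
  have hm' : (0 : ℝ) < m := by exact_mod_cast h.hm
  by_cases hz : ∃ j, ℓ j = 0
  · obtain ⟨j, hj⟩ := hz
    have h1 := E_sc' p S hSperm (fun _ => 0) ℓ (fun _ => Nat.zero_le _)
    have h2 : ∀ X : Fin m × ℕ → A, sc S X (fun _ => 0) ℓ = 0 := by
      intro X
      apply le_antisymm _ (h.sc_nonneg X _ _)
      have := h.sc_le X (fun _ => 0) ℓ j
      simpa [hj] using this
    have h3 := h1.2
    simp only [h2, integral_zero, Nat.sub_zero] at h3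
    rw [← h3]
    positivity
  push Not at hz
  set q : Fin m → ℝ := fun j => ℓ j / v with hq
  have hlpos : ∀ j, (0 : ℝ) < ℓ j := fun j => by exact_mod_cast Nat.pos_of_ne_zero (hz j)
  have hqpos : ∀ j, 0 < q j := fun j => div_pos (hlpos j) hv'
  have hq0 : q ⟨0, h.hm⟩ = 1 := by simp [hq, h0, hv'.ne']
  have hgq : g q ≤ δStar := by
    apply hoff q hqpos hq0
    obtain ⟨j, hj, hj'⟩ := hbad
    refine ⟨j, hj, ?_⟩
    simp only [hq]
    rw [div_lt_iff₀ hv', lt_div_iff₀ hv']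
    rcases hj' with h' | h'
    · left; linarith
    · right; linarith
  have h1 : Tendsto (fun k : ℕ => k * v) atTop atTop :=
    tendsto_id.atTop_mul_const' hv
  have hsum : (∑ j, q j) = ((∑ j, ℓ j : ℕ) : ℝ) / v := by
    simp only [hq]; push_cast; rw [Finset.sum_div]
  have hsl : (0 : ℝ) < ((∑ j, ℓ j : ℕ) : ℝ) := by
    push_cast
    exact Finset.sum_pos (fun j _ => hlpos j) ⟨⟨0, h.hm⟩, Finset.mem_univ _⟩
  have h2 := (((hg q hqpos hq0).comp h1).mul_const (((∑ j, ℓ j : ℕ) : ℝ) / m))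
  refine le_trans (ge_of_tendsto h2 ?_) (mul_le_mul_of_nonneg_right hgq (by positivity))
  filter_upwards [eventually_gt_atTop 0] with k hk
  have h3 := E_mul p h hSperm ℓ k
  have hk' : (0 : ℝ) < k := by exact_mod_cast hk
  have e1 : (fun j => ⌈((k * v : ℕ) : ℝ) * q j⌉₊) = fun j => k * ℓ j := by
    funext j
    have : ((k * v : ℕ) : ℝ) * q j = ((k * ℓ j : ℕ) : ℝ) := by
      simp only [hq]; push_cast; field_simp
    rw [this, Nat.ceil_natCast]
  simp only [Function.comp]
  rw [e1, hsum]
  have e2 : ((k * v : ℕ) : ℝ) * (((∑ j, ℓ j : ℕ) : ℝ) / v) / m =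
      k * (((∑ j, ℓ j : ℕ) : ℝ) / m) := by
    push_cast; field_simp
  rw [e2]
  rw [div_mul_eq_mul_div, le_div_iff₀ (by positivity)]
  have : 0 < ((∑ j, ℓ j : ℕ) : ℝ) / m := by positivity
  nlinarith

end Expect
section Core

lemma count_le (v d : ℕ) (hv : 0 < v) :
    (((Finset.univ : Finset (Fin d → Fin (v * d + 1))).filter
      fun b => ∑ k, (b k : ℕ) = v * d).card : ℝ) ≤ (Real.exp 1 * (1 + v)) ^ d := by
  have hv' : (0 : ℝ) < v := by exact_mod_cast hv
  set T := (Finset.univ : Finset (Fin d → Fin (v * d + 1))).filter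
      fun b => ∑ k, (b k : ℕ) = v * d with hT
  set x : ℝ := v / (1 + v) with hx
  have hx0 : 0 < x := by positivity
  have hx1 : x < 1 := by rw [hx, div_lt_one (by positivity)]; linarith
  have h1 : (T.card : ℝ) * x ^ (v * d) ≤ (1 + v : ℝ) ^ d := by
    calc (T.card : ℝ) * x ^ (v * d) = ∑ b ∈ T, x ^ (v * d) := by simp
      _ = ∑ b ∈ T, ∏ k, x ^ (b k : ℕ) := by
          refine Finset.sum_congr rfl fun b hb => ?_
          rw [Finset.prod_pow_eq_pow_sum, (Finset.mem_filter.1 hb).2]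
      _ ≤ ∑ b : Fin d → Fin (v * d + 1), ∏ k, x ^ (b k : ℕ) := by
          apply Finset.sum_le_sum_of_subset_of_nonneg (Finset.subset_univ _)
          intro b _ _
          positivity
      _ = (∑ i : Fin (v * d + 1), x ^ (i : ℕ)) ^ d := by
          have := Finset.prod_univ_sum (fun _ : Fin d => (Finset.univ : Finset (Fin (v * d + 1))))
            (fun _ i => x ^ (i : ℕ))
          simp only [Finset.prod_const, Finset.card_univ, Fintype.card_fin,
            Fintype.piFinset_univ] at this
          exact this.symm
      _ ≤ _ := by
          gcongr
          rw [Fin.sum_univ_eq_sum_range (fun i => x ^ i), geom_sum_eq hx1.ne]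
          have e : x - 1 = -(1 / (1 + v)) := by rw [hx]; field_simp; ring
          rw [e]
          have : 0 < x ^ (v * d + 1) := by positivity
          have e2 : (x ^ (v * d + 1) - 1) / -(1 / (1 + (v : ℝ))) =
            (1 - x ^ (v * d + 1)) * (1 + v) := by field_simp; ring
          rw [e2]
          nlinarith
  have h2 : 1 ≤ x ^ (v * d) * Real.exp 1 ^ d := by
    rw [pow_mul, ← mul_pow]
    apply one_le_pow₀
    have h3 : 1 ≤ x * Real.exp (1 / v) := by
      have := Real.add_one_le_exp (1 / (v : ℝ))
      calc (1 : ℝ) = x * (1 / v + 1) := by rw [hx]; field_simp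
        _ ≤ _ := by gcongr
    have h4 : Real.exp 1 = Real.exp (1 / v) ^ v := by
      rw [← Real.exp_nat_mul]; congr 1; field_simp
    rw [h4, ← mul_pow]
    exact one_le_pow₀ h3
  calc (T.card : ℝ) ≤ T.card * (x ^ (v * d) * Real.exp 1 ^ d) :=
        le_mul_of_one_le_right (by positivity) h2
    _ = (T.card * x ^ (v * d)) * Real.exp 1 ^ d := by ring
    _ ≤ (1 + v : ℝ) ^ d * Real.exp 1 ^ d := by gcongr
    _ = _ := by rw [mul_pow]; ring

variable {A : Type*} [MeasurableSpace A] [Finite A] [DiscreteMeasurableSpace A]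

noncomputable def extWord {A : Type*} [Nonempty A] {m n : ℕ} (w : Fin m → Fin n → A) :
    Fin m × ℕ → A :=
  fun q => if h : q.2 < n then w q.1 ⟨q.2, h⟩ else Classical.arbitrary A

lemma IsDecomp.le {m n d v : ℕ} {r : Fin m → ℕ → ℕ} (hr : IsDecomp m n d v r)
    (j : Fin m) (k : ℕ) (hk : k ≤ d) : r j k ≤ n := by
  rw [← (hr.2 j).2.2]; exact (hr.2 j).1 hk

lemma decompScore_eq_sc {A : Type*} {m n d v : ℕ} (S : (Fin m → A) → ℝ) (X : Fin m × ℕ → A)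
    (w : Fin m → Fin n → A) (hw : ∀ j i, w j i = X (j, i)) (r : Fin m → ℕ → ℕ)
    (hr : IsDecomp m n d v r) :
    decompScore S w d r = ∑ k ∈ Finset.range d, sc S X (fun j => r j k) (fun j => r j (k + 1)) := by
  unfold decompScore
  refine Finset.sum_congr rfl fun k hk => ?_
  exact blockScore_eq_sc S X w hw _ _ (fun j => hr.le j _ (Finset.mem_range.1 hk))

lemma decomp_E (p : Measure A) [IsProbabilityMeasure p] {m : ℕ} {S : (Fin m → A) → ℝ}
    {sStar : ℝ} (h : SHyp S sStar) (hSperm : PermInvariant S) (γ δStar : ℝ)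
    (hγ : Tendsto (fun n : ℕ => expL p m n S / n) atTop (nhds γ))
    (g : (Fin m → ℝ) → ℝ)
    (hg : ∀ q : Fin m → ℝ, (∀ j, 0 < q j) → q ⟨0, h.hm⟩ = 1 →
      Tendsto (fun n : ℕ => expLV p (fun j => ⌈(n : ℝ) * q j⌉₊) S /
        ((n : ℝ) * (∑ j, q j) / m)) atTop (nhds (g q)))
    (p1 p2 : Fin m → ℝ)
    (hoff : ∀ q : Fin m → ℝ, (∀ j, 0 < q j) → q ⟨0, h.hm⟩ = 1 →
      (∃ j : Fin m, (j : ℕ) ≠ 0 ∧ (q j < p1 j ∨ p2 j < q j)) → g q ≤ δStar)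
    (hδ : 0 < δStar) (hδγ : δStar < γ) (v : ℕ) (hv : 0 < v) (n d : ℕ)
    (r : Fin m → ℕ → ℕ) (hr : IsDecomp m n d v r) :
    ∫ w, decompScore S w d r ∂(wordMeasure p m n) ≤
      γ * n - (γ - δStar) * (v / m) *
        (d - ((Finset.range d).filter fun k => GoodCell m v p1 p2 r k).card) := by
  have hm' : (0 : ℝ) < m := by exact_mod_cast h.hm
  have hmp := map_wordMeasureV p (fun _ : Fin m => n) (κ := Fin m × ℕ)
    (fun j i => (j, (i : ℕ))) (by
      rintro ⟨a, b⟩ ⟨a', b'⟩ h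
      simp only [Prod.mk.injEq, Fin.val_inj] at h
      simp [h.1, h.2])
  have e : wordMeasureV p (fun _ : Fin m => n) = wordMeasure p m n := rfl
  rw [e] at hmp
  rw [← hmp.map_eq, integral_map hmp.measurable.aemeasurable
        Measurable.of_discrete.aestronglyMeasurable]
  have e1 : ∀ X : Fin m × ℕ → A, decompScore S (fun (j : Fin m) (i : Fin n) => X (j, (i : ℕ))) d r =
    ∑ k ∈ Finset.range d, sc S X (fun j => r j k) (fun j => r j (k + 1)) := fun X =>
      decompScore_eq_sc S X _ (fun _ _ => rfl) r hr
  simp only [e1]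
  have hE := fun k => E_sc' p S hSperm (fun j => r j k) (fun j => r j (k + 1))
    (fun j => (hr.2 j).1 (Nat.le_succ k))
  rw [integral_finsetSum _ (fun k _ => (hE k).1)]
  have hcell : ∀ k, ∫ X, sc S X (fun j => r j k) (fun j => r j (k + 1))
      ∂(Measure.infinitePi fun _ : Fin m × ℕ => p) ≤
      γ * ((∑ j, (r j (k + 1) - r j k) : ℕ) / m) -
        (γ - δStar) * (v / m) * (1 - if GoodCell m v p1 p2 r k then (1 : ℝ) else 0) := by
    intro k
    rw [(hE k).2]
    have h0 : r ⟨0, h.hm⟩ (k + 1) - r ⟨0, h.hm⟩ k = v := by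
      rw [hr.1 _ rfl, hr.1 _ rfl, mul_add]; simp
    have hW : v ≤ ∑ j, (r j (k + 1) - r j k) := by
      calc v = r ⟨0, h.hm⟩ (k + 1) - r ⟨0, h.hm⟩ k := h0.symm
        _ ≤ _ := Finset.single_le_sum (f := fun j => r j (k + 1) - r j k)
          (fun _ _ => Nat.zero_le _) (Finset.mem_univ _)
    split_ifs with hgc
    · simp only [sub_self, mul_zero, sub_zero]
      exact cell_le p h hSperm γ hγ _ (lt_of_lt_of_le hv hW)
    · have hb := bad_cell_le p h hSperm δStar g hg p1 p2 hoff hδ v hv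
        (fun j => r j (k + 1) - r j k) h0 (by
          unfold GoodCell at hgc
          push Not at hgc
          obtain ⟨j, hj, hj'⟩ := hgc
          refine ⟨j, hj, ?_⟩
          rw [Nat.cast_sub ((hr.2 j).1 (Nat.le_succ k))]
          by_cases hc : (v : ℝ) * p1 j ≤ (r j (k + 1) : ℝ) - (r j k : ℝ)
          · exact Or.inr (hj' hc)
          · exact Or.inl (not_le.1 hc))
      refine hb.trans ?_
      have hW' : (v : ℝ) / m ≤ (∑ j, (r j (k + 1) - r j k) : ℕ) / m := by
        gcongr
      nlinarith
  refine (Finset.sum_le_sum fun k _ => hcell k).trans (le_of_eq ?_)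
  rw [Finset.sum_sub_distrib, ← Finset.mul_sum, ← Finset.mul_sum, Finset.sum_sub_distrib,
    ← Finset.sum_div]
  have hs : ∑ k ∈ Finset.range d, ((∑ j, (r j (k + 1) - r j k) : ℕ) : ℝ) = m * n := by
    have h1 : ∑ k ∈ Finset.range d, ∑ j, (r j (k + 1) - r j k) = m * n := by
      rw [Finset.sum_comm]
      rw [Finset.sum_congr rfl (fun j _ => Finset.sum_range_tsub (hr.2 j).1 d)]
      simp [(hr.2 _).2.1, (hr.2 _).2.2]
    exact_mod_cast h1
  rw [hs]
  congr 2
  · field_simp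
  · simp

lemma decomp_prob [Nonempty A] (p : Measure A) [IsProbabilityMeasure p] {m : ℕ}
    {S : (Fin m → A) → ℝ}
    {sStar : ℝ} (h : SHyp S sStar) (D : ℝ) (hD : 0 < D) (hBD : BddDiffOne S D)
    (n d v : ℕ) (hn : 0 < n)
    (r : Fin m → ℕ → ℕ) (hr : IsDecomp m n d v r) (s : ℝ) (hs : 0 ≤ s)
    (hE : ∫ w, decompScore S w d r ∂(wordMeasure p m n) ≤ expL p m n S - s) :
    (wordMeasure p m n).real {w | decompScore S w d r = optScore m n S w} ≤
      Real.exp (- (2 * s ^ 2 / ((m * n : ℕ) * (2 * D) ^ 2))) := by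
  have : IsProbabilityMeasure (wordMeasure p m n) := by unfold wordMeasure; infer_instance
  have h1 := mcd_word p m n (Nat.mul_pos h.hm hn) (2 * D) (by linarith) s hs
    (fun w => decompScore S w d r - optScore m n S w) (by
      intro x y j i hxy
      have hx : ∀ (x : Fin m → Fin n → A) (j : Fin m) (i : Fin n), x j i = extWord x (j, i) := by
        intro x j i; simp [extWord]
      have hX : ∀ q, q ≠ (j, (i : ℕ)) → extWord x q = extWord y q := by
        rintro ⟨j', i'⟩ hq
        unfold extWord
        split_ifs with hi
        · apply hxy
          intro hh
          apply hq
          obtain ⟨h6, h7⟩ := Prod.mk.inj hh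
          simp only at h6
          rw [h6, ← h7]
        · rfl
      have a1 := h.sc_sum_diff hD.le hBD (extWord x) (extWord y) j i hX r
        (fun j => (hr.2 j).1) d
      have a2 := h.sc_diff hD.le hBD (extWord y) (extWord x) j i
        (fun q hq => (hX q hq).symm) (fun _ => 0) (fun _ => n)
      rw [decompScore_eq_sc S (extWord x) x (hx x) r hr,
        decompScore_eq_sc S (extWord y) y (hx y) r hr,
        optScore_eq_sc S (extWord x) x (hx x), optScore_eq_sc S (extWord y) y (hx y)]
      split_ifs at a2 <;> linarith) (by
      rw [integral_sub Integrable.of_finite Integrable.of_finite]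
      unfold expL at hE
      linarith)
  refine le_trans (measureReal_mono ?_ (measure_ne_top _ _)) h1
  intro w hw
  have hw' : decompScore S w d r = optScore m n S w := hw
  show 0 ≤ decompScore S w d r - optScore m n S w
  rw [hw']; simp

lemma core [Nonempty A]
    (p : Measure A) [IsProbabilityMeasure p]
    (m : ℕ) (hm : 2 ≤ m) (hm0 : 0 < m) (S : (Fin m → A) → ℝ) (hS0 : ∀ x, 0 ≤ S x)
    (sStar : ℝ) (hSb : ∀ x, S x ≤ sStar) (hSperm : PermInvariant S)
    (D : ℝ) (hD0 : 0 < D) (hBD : BddDiffOne S D)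
    (γ δStar : ℝ)
    (hγ : Tendsto (fun n : ℕ => expL p m n S / n) atTop (nhds γ))
    (g : (Fin m → ℝ) → ℝ)
    (hg : ∀ q : Fin m → ℝ, (∀ j, 0 < q j) → q ⟨0, hm0⟩ = 1 →
      Tendsto (fun n : ℕ => expLV p (fun j => ⌈(n : ℝ) * q j⌉₊) S /
        ((n : ℝ) * (∑ j, q j) / m)) atTop (nhds (g q)))
    (p1 p2 : Fin m → ℝ)
    (hoff : ∀ q : Fin m → ℝ, (∀ j, 0 < q j) → q ⟨0, hm0⟩ = 1 →
      (∃ j : Fin m, (j : ℕ) ≠ 0 ∧ (q j < p1 j ∨ p2 j < q j)) → g q ≤ δStar)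
    (hδ : 0 < δStar ∧ δStar < γ)
    (η ε : ℝ) (hη : 0 < η ∧ η < γ - δStar) (hε : 0 < ε)
    (v : ℕ) (hv1 : 1 ≤ v) :
    ∃ N : ℕ, ∀ n d : ℕ, N ≤ n → n = v * d →
      1 - Real.exp (-(n : ℝ) * (-((1 + Real.log (1 + v)) / v) * ((m : ℝ) - 1) +
          η ^ 2 * ε ^ 2 / (2 * (m : ℝ) ^ 3 * D ^ 2))) ≤
        ((wordMeasure p m n) {w | ∀ r : Fin m → ℕ → ℕ, IsDecomp m n d v r →
          decompScore S w d r = optScore m n S w →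
          (1 - ε) * d ≤
            (((Finset.range d).filter fun k => GoodCell m v p1 p2 r k).card : ℝ)}).toReal := by
  have hm' : (0 : ℝ) < m := by exact_mod_cast hm0
  have hv' : (0 : ℝ) < v := by exact_mod_cast hv1
  have h : SHyp S sStar := ⟨hm0, hS0, hSb, (hS0 (fun _ => Classical.arbitrary A)).trans (hSb _)⟩
  -- large n
  set τ : ℝ := (γ - δStar - η) * ε / m with hτ
  have hτ0 : 0 < τ := by
    have : 0 < γ - δStar - η := by linarith [hη.2]
    positivity
  have hev : ∀ᶠ n : ℕ in atTop, γ - τ < expL p m n S / n :=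
    hγ.eventually (lt_mem_nhds (by linarith))
  obtain ⟨N, hN⟩ := eventually_atTop.1 hev
  refine ⟨max N 1, fun n d hn hnd => ?_⟩
  have hn0 : 0 < n := lt_of_lt_of_le one_pos ((le_max_right N 1).trans hn)
  have hn0' : (0 : ℝ) < n := by exact_mod_cast hn0
  have hEL : (γ - τ) * n ≤ expL p m n S := by
    have := hN n ((le_max_left N 1).trans hn)
    rw [lt_div_iff₀ hn0'] at this
    exact this.le
  have hndR : (n : ℝ) = v * d := by rw [hnd]; push_cast; ring
  have : IsProbabilityMeasure (wordMeasure p m n) := by unfold wordMeasure; infer_instance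
  set E : Set (Fin m → Fin n → A) := {w | ∀ r : Fin m → ℕ → ℕ, IsDecomp m n d v r →
          decompScore S w d r = optScore m n S w →
          (1 - ε) * d ≤
            (((Finset.range d).filter fun k => GoodCell m v p1 p2 r k).card : ℝ)} with hEdef
  set x : ℝ := n * (η ^ 2 * ε ^ 2 / (2 * (m : ℝ) ^ 3 * D ^ 2)) with hx
  -- index set
  set J := {j : Fin m // (j : ℕ) ≠ 0} with hJ
  set T := (Finset.univ : Finset (Fin d → Fin (v * d + 1))).filter
      fun b => ∑ k, (b k : ℕ) = v * d with hT
  set B : Finset (J → Fin d → Fin (v * d + 1)) := Fintype.piFinset fun _ => T with hB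
  set F : (J → Fin d → Fin (v * d + 1)) → Set (Fin m → Fin n → A) := fun b =>
    {w | ∃ r : Fin m → ℕ → ℕ, IsDecomp m n d v r ∧ decompScore S w d r = optScore m n S w ∧
      (((Finset.range d).filter fun k => GoodCell m v p1 p2 r k).card : ℝ) < (1 - ε) * d ∧
      ∀ (j : J) (k : Fin d), r j.1 (k + 1) = r j.1 k + b j k} with hF
  have hcover : Eᶜ ⊆ ⋃ b ∈ B, F b := by
    intro w hw
    have hw' : ¬ (∀ r : Fin m → ℕ → ℕ, IsDecomp m n d v r →
          decompScore S w d r = optScore m n S w →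
          (1 - ε) * d ≤
            (((Finset.range d).filter fun k => GoodCell m v p1 p2 r k).card : ℝ)) := hw
    push Not at hw'
    obtain ⟨r, hr, h1, h2⟩ := hw'
    have hmono := fun j => (hr.2 j).1
    set b : J → Fin d → Fin (v * d + 1) := fun j k => ⟨r j.1 (k + 1) - r j.1 k, by
      have := hr.le j.1 (k + 1) k.2
      omega⟩ with hb
    refine Set.mem_iUnion₂.2 ⟨b, ?_, r, hr, h1, h2, ?_⟩
    · rw [hB, Fintype.mem_piFinset]
      intro j
      rw [hT, Finset.mem_filter]
      refine ⟨Finset.mem_univ _, ?_⟩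
      simp only [hb]
      rw [Fin.sum_univ_eq_sum_range (fun k => r j.1 (k + 1) - r j.1 k),
        Finset.sum_range_tsub (hmono j.1), (hr.2 j.1).2.1, (hr.2 j.1).2.2, hnd]
      simp
    · intro j k
      simp only [hb]
      have := hmono j.1 (Nat.le_succ (k : ℕ))
      simp only [Nat.succ_eq_add_one] at this
      omega
  have hFb : ∀ b, (wordMeasure p m n).real (F b) ≤ Real.exp (-x) := by
    intro b
    by_cases hne : ∃ r : Fin m → ℕ → ℕ, IsDecomp m n d v r ∧
      (((Finset.range d).filter fun k => GoodCell m v p1 p2 r k).card : ℝ) < (1 - ε) * d ∧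
      ∀ (j : J) (k : Fin d), r j.1 (k + 1) = r j.1 k + b j k
    · obtain ⟨r, hr, hbad, hrb⟩ := hne
      have hsub : F b ⊆ {w | decompScore S w d r = optScore m n S w} := by
        rintro w ⟨r', hr', h1, -, h2⟩
        have heq : ∀ k ≤ d, ∀ j, r j k = r' j k := by
          intro k
          induction k with
          | zero => intro _ j; rw [(hr.2 j).2.1, (hr'.2 j).2.1]
          | succ k ih =>
            intro hk j
            by_cases hj : (j : ℕ) = 0
            · rw [hr.1 j hj, hr'.1 j hj]
            · have a := hrb ⟨j, hj⟩ ⟨k, hk⟩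
              have a' := h2 ⟨j, hj⟩ ⟨k, hk⟩
              simp only at a a'
              rw [a, a', ih (by omega)]
        show decompScore S w d r = optScore m n S w
        rw [← h1]
        unfold decompScore
        refine Finset.sum_congr rfl fun k hk => ?_
        have hk' := Finset.mem_range.1 hk
        simp only [heq k hk'.le, heq (k + 1) hk']
      refine (measureReal_mono hsub (measure_ne_top _ _)).trans ?_
      have hdE := decomp_E p h hSperm γ δStar hγ g hg p1 p2 hoff hδ.1 hδ.2 v hv1 n d r hr
      set s : ℝ := η * ε * n / m with hs
      have hs0 : 0 ≤ s := by have := hη.1; positivity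
      have hP := decomp_prob p h D hD0 hBD n d v hn0 r hr s hs0 (by
        refine hdE.trans ?_
        have h1 : (γ - δStar) * (v / m) * (ε * d) ≤ (γ - δStar) * (v / m) *
          (d - ((Finset.range d).filter fun k => GoodCell m v p1 p2 r k).card) := by
          have : 0 < (γ - δStar) * (v / m) := by
            have : 0 < γ - δStar := by linarith [hδ.2]
            positivity
          apply mul_le_mul_of_nonneg_left _ this.le
          linarith
        have h2 : (γ - δStar) * (v / m) * (ε * d) = τ * n + s := by
          rw [hτ, hs, hndR]; field_simp; ring
        linarith)
      refine hP.trans (le_of_eq ?_)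
      congr 2
      rw [hs, hx]
      push_cast
      field_simp
    · have : F b = ∅ := by
        ext w
        simp only [Set.mem_empty_iff_false, iff_false]
        rintro ⟨r, hr, -, h1, h2⟩
        exact hne ⟨r, hr, h1, h2⟩
      rw [this]
      simp [Real.exp_nonneg]
  have hJc : Fintype.card J = m - 1 := by
    have h1 : Fintype.card J = Fintype.card {j : Fin m // j ≠ ⟨0, hm0⟩} := by
      apply Fintype.card_congr
      apply Equiv.subtypeEquivRight
      intro j
      simp [Fin.ext_iff]
    rw [h1, Fintype.card_subtype_compl]
    simp
  have hBc : (B.card : ℝ) ≤ ((Real.exp 1 * (1 + v)) ^ d) ^ (m - 1) := by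
    rw [hB, Fintype.card_piFinset, Finset.prod_const, Finset.card_univ, hJc]
    push_cast
    gcongr
    exact count_le v d hv1
  have hEc : (wordMeasure p m n).real Eᶜ ≤ ((Real.exp 1 * (1 + v)) ^ d) ^ (m - 1) * Real.exp (-x) := by
    calc (wordMeasure p m n).real Eᶜ ≤ (wordMeasure p m n).real (⋃ b ∈ B, F b) :=
          measureReal_mono hcover (measure_ne_top _ _)
      _ ≤ ∑ b ∈ B, (wordMeasure p m n).real (F b) := measureReal_biUnion_finset_le _ _
      _ ≤ ∑ b ∈ B, Real.exp (-x) := Finset.sum_le_sum fun b _ => hFb b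
      _ = B.card * Real.exp (-x) := by simp
      _ ≤ _ := by gcongr
  have hcompl : (wordMeasure p m n).real E = 1 - (wordMeasure p m n).real Eᶜ := by
    rw [probReal_compl_eq_one_sub MeasurableSet.of_discrete]; ring
  change _ ≤ (wordMeasure p m n).real E
  rw [hcompl]
  have hfin : ((Real.exp 1 * (1 + v)) ^ d) ^ (m - 1) * Real.exp (-x) =
      Real.exp (-(n : ℝ) * (-((1 + Real.log (1 + v)) / v) * ((m : ℝ) - 1) +
          η ^ 2 * ε ^ 2 / (2 * (m : ℝ) ^ 3 * D ^ 2))) := by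
    have e1 : Real.exp 1 * (1 + v) = Real.exp (1 + Real.log (1 + v)) := by
      rw [Real.exp_add, Real.exp_log (by positivity)]
    rw [e1, ← Real.exp_nat_mul, ← Real.exp_nat_mul, ← Real.exp_add]
    congr 1
    rw [Nat.cast_sub (by omega), hx]
    have e2 : (n : ℝ) * ((1 + Real.log (1 + v)) / v) = d * (1 + Real.log (1 + v)) := by
      rw [hndR]; field_simp
    push_cast
    linear_combination (-((m : ℝ) - 1)) * e2
  rw [← hfin]
  linarith

end Core
section Reduction

variable {A : Type*} [MeasurableSpace A]

lemma ae_word (p : Measure A) [IsProbabilityMeasure p] {m : ℕ} (ℓ : Fin m → ℕ) (G : Set A)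
    (hG : ∀ᵐ a ∂p, a ∈ G) : ∀ᵐ w ∂(wordMeasureV p ℓ), ∀ j i, w j i ∈ G := by
  unfold wordMeasureV
  rw [ae_all_iff]
  intro j
  rw [ae_all_iff]
  intro i
  have h1 : ∀ᵐ u ∂(Measure.pi fun _ : Fin (ℓ j) => p), u i ∈ G :=
    (Measure.quasiMeasurePreserving_eval (fun _ : Fin (ℓ j) => p) i).ae hG
  exact (Measure.quasiMeasurePreserving_eval
    (fun j : Fin m => Measure.pi fun _ : Fin (ℓ j) => p) j).ae h1

lemma map_word {B : Type*} [MeasurableSpace B] (p : Measure A) [IsProbabilityMeasure p]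
    (f : A → B) (hf : Measurable f) {m : ℕ} (ℓ : Fin m → ℕ) :
    MeasurePreserving (fun (w : ∀ j : Fin m, Fin (ℓ j) → A) j i => f (w j i))
      (wordMeasureV p ℓ) (wordMeasureV (p.map f) ℓ) := by
  have hpf : IsProbabilityMeasure (p.map f) := Measure.isProbabilityMeasure_map hf.aemeasurable
  have h1 : ∀ n : ℕ, MeasurePreserving (fun (u : Fin n → A) i => f (u i))
      (Measure.pi fun _ => p) (Measure.pi fun _ => p.map f) := fun n =>
    measurePreserving_pi _ _ (fun _ => ⟨hf, rfl⟩)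
  exact measurePreserving_pi _ _ (fun j => h1 (ℓ j))

structure RedHyp {B : Type*} [MeasurableSpace B] (p : Measure A) {m : ℕ}
    (S : (Fin m → A) → ℝ) (proj : A → B) (rep : B → A) (G : Set A) : Prop where
  meas : Measurable proj
  ae : ∀ᵐ a ∂p, a ∈ G
  eq : ∀ x, (∀ j, x j ∈ G) → S x = S (fun j => rep (proj (x j)))

variable {B : Type*} [MeasurableSpace B] {p : Measure A} {m : ℕ}
    {S : (Fin m → A) → ℝ} {proj : A → B} {rep : B → A} {G : Set A}

lemma RedHyp.optV (h : RedHyp p S proj rep G) (ℓ : Fin m → ℕ)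
    (w : ∀ j : Fin m, Fin (ℓ j) → A) (hw : ∀ j i, w j i ∈ G) :
    optScoreV m ℓ S w =
      optScoreV m ℓ (fun y => S (fun j => rep (y j))) (fun j i => proj (w j i)) := by
  unfold optScoreV
  have : ∀ (k : ℕ) (π : ∀ j : Fin m, Fin k → Fin (ℓ j)) (i : Fin k), S (fun j => w j (π j i)) =
      S (fun j => rep (proj (w j (π j i)))) := fun k π i => h.eq _ (fun j => hw _ _)
  simp only [this]

lemma RedHyp.block (h : RedHyp p S proj rep G) {n : ℕ}
    (w : Fin m → Fin n → A) (hw : ∀ j i, w j i ∈ G) (lo hi : Fin m → ℕ) :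
    blockScore S w lo hi =
      blockScore (fun y => S (fun j => rep (y j))) (fun j i => proj (w j i)) lo hi := by
  unfold blockScore
  have : ∀ (k : ℕ) (π : Fin m → Fin k → Fin n) (i : Fin k), S (fun j => w j (π j i)) =
      S (fun j => rep (proj (w j (π j i)))) := fun k π i => h.eq _ (fun j => hw _ _)
  simp only [this]

lemma RedHyp.expLV [IsProbabilityMeasure p] [Finite B] [DiscreteMeasurableSpace B]
    (h : RedHyp p S proj rep G) (ℓ : Fin m → ℕ) :
    expLV p ℓ S = expLV (p.map proj) ℓ (fun y => S (fun j => rep (y j))) := by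
  unfold _root_.expLV
  have hmp := map_word p proj h.meas ℓ
  rw [← hmp.map_eq, integral_map hmp.measurable.aemeasurable
        Measurable.of_discrete.aestronglyMeasurable]
  apply integral_congr_ae
  filter_upwards [ae_word p ℓ G h.ae] with w hw
  exact h.optV ℓ w hw

/-- The σ-algebra of sets saturated for a relation. -/
@[reducible] def satSpace {α : Type*} (R : α → α → Prop) : MeasurableSpace α where
  MeasurableSet' s := ∀ x y, R x y → (x ∈ s ↔ y ∈ s)
  measurableSet_empty := by simp
  measurableSet_compl s hs x y hxy := by simp [hs x y hxy]
  measurableSet_iUnion f hf x y hxy := by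
    simp only [Set.mem_iUnion]
    exact exists_congr fun i => hf i x y hxy

lemma pi_le_sat {ι : Type*} {α : ι → Type*} [M : ∀ i, MeasurableSpace (α i)]
    (R : ∀ i, α i → α i → Prop) (h : ∀ i, M i ≤ satSpace (R i)) :
    MeasurableSpace.pi ≤ satSpace (fun x y : ∀ i, α i => ∀ i, R i (x i) (y i)) := by
  refine iSup_le fun i => ?_
  rintro s ⟨t, ht, rfl⟩ x y hxy
  exact h i t ht _ _ (hxy i)

lemma optScore_const {A : Type*} {m n : ℕ} (hm : 0 < m) (S : (Fin m → A) → ℝ)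
    (hS0 : ∀ x, 0 ≤ S x) (x : Fin m → A) :
    optScore m n S (fun j _ => x j) = n * S x := by
  unfold optScore
  refine IsLUB.csSup_eq ?_
    ⟨(0 : ℝ), 0, fun _ i => i.elim0, fun _ i => i.elim0, by simp [alignScore]⟩
  constructor
  · rintro y ⟨k, π, h1, rfl⟩
    have hk : k ≤ n := by
      simpa using Fintype.card_le_of_injective _ (h1 ⟨0, hm⟩).injective
    simp only [alignScore, Finset.sum_const, Finset.card_univ, Fintype.card_fin, nsmul_eq_mul]
    have := hS0 x
    gcongr
  · intro y hy
    apply hy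
    exact ⟨n, fun _ i => i, fun _ => strictMono_id, by simp [alignScore]⟩

/-- If the expectation does not vanish, the score is constant on products of non-null atoms. -/
lemma S_atom [Finite A] (p : Measure A) [IsProbabilityMeasure p] (m n : ℕ) (hm : 0 < m)
    (hn : 0 < n)
    (S : (Fin m → A) → ℝ) (hS0 : ∀ x, 0 ≤ S x) (hE : expL p m n S ≠ 0) (x y : Fin m → A)
    (hx : ∀ j, p (measurableAtom (x j)) ≠ 0)
    (hxy : ∀ j, measurableAtom (x j) = measurableAtom (y j)) : S x = S y := by
  have hint : Integrable (optScore m n S) (wordMeasure p m n) := by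
    by_contra hcon
    exact hE (integral_undef hcon)
  obtain ⟨f, hf, hfe⟩ := hint.aestronglyMeasurable
  have hfm := hf.measurable
  have hsat : (MeasurableSpace.pi : MeasurableSpace (Fin m → Fin n → A)) ≤
      satSpace (fun u w => ∀ j i, measurableAtom (u j i) = measurableAtom (w j i)) := by
    apply pi_le_sat (R := fun _ (u w : Fin n → A) => ∀ i, measurableAtom (u i) = measurableAtom (w i))
    intro j
    apply pi_le_sat (R := fun _ (u w : A) => measurableAtom u = measurableAtom w)
    intro i s hs u w huw
    constructor
    · intro hu
      exact measurableAtom_subset hs hu (huw ▸ mem_measurableAtom_self w)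
    · intro hu
      exact measurableAtom_subset hs hu (huw ▸ mem_measurableAtom_self u)
  have hgood : ∀ z : Fin m → A, (∀ j, measurableAtom (x j) = measurableAtom (z j)) →
      optScore m n S (fun j _ => z j) = f (fun j _ => z j) := by
    intro z hz
    by_contra hcon
    have hnull : wordMeasure p m n {w | ¬ optScore m n S w = f w} = 0 := ae_iff.1 hfe
    obtain ⟨t, hst, htm, ht0⟩ := exists_measurable_superset_of_null hnull
    have hzt : (fun (j : Fin m) (_ : Fin n) => z j) ∈ t := hst hcon
    have hsub : Set.pi Set.univ (fun j : Fin m => Set.pi Set.univ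
        (fun _ : Fin n => measurableAtom (z j))) ⊆ t := by
      intro w hw
      refine (hsat t htm _ _ ?_).1 hzt
      intro j i
      exact (measurableAtom_eq_of_mem (hw j (Set.mem_univ _) i (Set.mem_univ _))).symm
    have h0 := measure_mono_null hsub ht0
    unfold wordMeasure at h0
    rw [Measure.pi_pi] at h0
    simp only [Measure.pi_pi, Finset.prod_const] at h0
    rw [Finset.prod_eq_zero_iff] at h0
    obtain ⟨j, -, hj⟩ := h0
    apply hx j
    rw [hz j]
    exact eq_zero_of_pow_eq_zero hj
  have hfxy : f (fun j _ => y j) = f (fun j _ => x j) := by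
    have := hsat (f ⁻¹' {f (fun j _ => x j)}) (hfm (measurableSet_singleton _))
      (fun j _ => x j) (fun j _ => y j) (fun j _ => hxy j)
    exact this.1 rfl
  have h1 := hgood x (fun _ => rfl)
  have h2 := hgood y hxy
  rw [optScore_const hm S hS0] at h1 h2
  have hn' : (n : ℝ) ≠ 0 := by exact_mod_cast hn.ne'
  apply mul_left_cancel₀ hn'
  rw [h1, h2, hfxy]

end Reduction
theorem stmt12
    {A : Type*} [Fintype A] [Nonempty A] [MeasurableSpace A]
    (p : Measure A) [IsProbabilityMeasure p]
    (m : ℕ) (hm : 2 ≤ m) (S : (Fin m → A) → ℝ) (hS0 : ∀ x, 0 ≤ S x)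
    (sStar : ℝ) (hSb : ∀ x, S x ≤ sStar) (hSperm : PermInvariant S)
    (D : ℝ) (hD0 : 0 < D) (hBD : BddDiffOne S D)
    (γ δStar : ℝ)
    (hγ : Tendsto (fun n : ℕ => expL p m n S / n) atTop (nhds γ))
    (g : (Fin m → ℝ) → ℝ)
    (hg : ∀ q : Fin m → ℝ, (∀ j, 0 < q j) → q ⟨0, by omega⟩ = 1 →
      Tendsto (fun n : ℕ => expLV p (fun j => ⌈(n : ℝ) * q j⌉₊) S /
        ((n : ℝ) * (∑ j, q j) / m)) atTop (nhds (g q)))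
    (p1 p2 : Fin m → ℝ)
    (hp : ∀ j : Fin m, (j : ℕ) ≠ 0 → 0 < p1 j ∧ p1 j < 1 ∧ 1 < p2 j)
    (hoff : ∀ q : Fin m → ℝ, (∀ j, 0 < q j) → q ⟨0, by omega⟩ = 1 →
      (∃ j : Fin m, (j : ℕ) ≠ 0 ∧ (q j < p1 j ∨ p2 j < q j)) → g q ≤ δStar)
    (hδ : 0 < δStar ∧ δStar < γ)
    (η ε : ℝ) (hη : 0 < η ∧ η < γ - δStar) (hε : 0 < ε)
    (v : ℕ) (hv1 : 1 ≤ v)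
    (hv : (1 + Real.log (1 + v)) / v ≤
      η ^ 2 * ε ^ 2 / (2 * (m : ℝ) ^ 3 * ((m : ℝ) - 1) * D ^ 2)) :
    ∃ N : ℕ, ∀ n d : ℕ, N ≤ n → n = v * d →
      1 - Real.exp (-(n : ℝ) * (-((1 + Real.log (1 + v)) / v) * ((m : ℝ) - 1) +
          η ^ 2 * ε ^ 2 / (2 * (m : ℝ) ^ 3 * D ^ 2))) ≤
        ((wordMeasure p m n) {w | ∀ r : Fin m → ℕ → ℕ, IsDecomp m n d v r →
          decompScore S w d r = optScore m n S w →
          (1 - ε) * d ≤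
            (((Finset.range d).filter fun k => GoodCell m v p1 p2 r k).card : ℝ)}).toReal := by
  classical
  have hm0 : 0 < m := by omega
  obtain ⟨n0, hn0, hE0⟩ : ∃ n : ℕ, 0 < n ∧ expL p m n S ≠ 0 := by
    have h1 := hγ.eventually (lt_mem_nhds (hδ.1.trans hδ.2))
    obtain ⟨n, hn, hn'⟩ := (h1.and (eventually_gt_atTop 0)).exists
    refine ⟨n, hn', ?_⟩
    intro h0
    rw [h0] at hn
    simp at hn
  let st : Setoid A := ⟨fun a b => measurableAtom a = measurableAtom b,
    ⟨fun _ => rfl, fun h => h.symm, fun h h' => h.trans h'⟩⟩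
  let B := Quotient st
  let mB : MeasurableSpace B := ⊤
  have hdB : DiscreteMeasurableSpace B := ⟨fun _ => trivial⟩
  have hfB : Finite B := inferInstance
  have hnB : Nonempty B := ⟨Quotient.mk st (Classical.arbitrary A)⟩
  let proj : A → B := fun a => Quotient.mk st a
  let rep : B → A := fun b => b.out
  have hrp : ∀ a, measurableAtom a = measurableAtom (rep (proj a)) := by
    intro a
    exact (Quotient.mk_out (s := st) a).symm
  have hmeas : Measurable proj := by
    intro s _
    have : proj ⁻¹' s = ⋃ a ∈ proj ⁻¹' s, measurableAtom a := by
      ext z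
      simp only [Set.mem_iUnion]
      constructor
      · intro hz; exact ⟨z, hz, mem_measurableAtom_self z⟩
      · rintro ⟨a, ha, hz⟩
        have h1 : proj z = proj a := Quotient.sound (s := st) (measurableAtom_eq_of_mem hz)
        show proj z ∈ s
        rw [h1]; exact ha
    rw [this]
    exact MeasurableSet.biUnion (Set.to_countable _)
      (fun a _ => MeasurableSet.measurableAtom_of_countable a)
  let G : Set A := {a | p (measurableAtom a) ≠ 0}
  have hG : ∀ᵐ a ∂p, a ∈ G := by
    rw [ae_iff]
    have h1 : {a | ¬ a ∈ G} ⊆ ⋃ a ∈ {a | ¬ a ∈ G}, measurableAtom a := by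
      intro a ha
      exact Set.mem_iUnion₂.2 ⟨a, ha, mem_measurableAtom_self a⟩
    refine measure_mono_null h1 ?_
    rw [measure_biUnion_null_iff (Set.to_countable _)]
    intro a ha
    exact not_not.1 ha
  have hR : RedHyp p S proj rep G := ⟨hmeas, hG, fun x hx =>
    S_atom p m n0 hm0 hn0 S hS0 hE0 x _ hx (fun j => hrp (x j))⟩
  have hpB : IsProbabilityMeasure (p.map proj) :=
    Measure.isProbabilityMeasure_map hmeas.aemeasurable
  have hEL : ∀ n : ℕ, expL (p.map proj) m n (fun y => S (fun j => rep (y j))) = expL p m n S := by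
    intro n
    rw [expL_eq_V, expL_eq_V]
    exact (hR.expLV _).symm
  obtain ⟨N, hN⟩ := core (p.map proj) m hm hm0 (fun y => S (fun j => rep (y j)))
    (fun _ => hS0 _) sStar (fun _ => hSb _)
    (fun σ x => hSperm σ (fun j => rep (x j))) D hD0
    (by
      rintro x y ⟨j0, hj0⟩
      exact hBD _ _ ⟨j0, fun j hj => by rw [hj0 j hj]⟩)
    γ δStar (by simpa only [hEL] using hγ) g
    (by
      intro q hq hq0
      have := hg q hq hq0
      simp only [hR.expLV] at this
      exact this)
    p1 p2 hoff hδ η ε hη hε v hv1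
  refine ⟨N, fun n d hn hnd => (hN n d hn hnd).trans (le_of_eq ?_)⟩
  congr 1
  have hmp := map_word p proj hmeas (fun _ : Fin m => n)
  have e : wordMeasureV p (fun _ : Fin m => n) = wordMeasure p m n := rfl
  have e' : wordMeasureV (p.map proj) (fun _ : Fin m => n) = wordMeasure (p.map proj) m n := rfl
  rw [← e', ← hmp.measure_preimage MeasurableSet.of_discrete.nullMeasurableSet, ← e]
  apply measure_congr
  filter_upwards [ae_word p (fun _ : Fin m => n) G hG] with w hw
  apply propext
  have hd : ∀ r, decompScore S w d r =
      decompScore (fun y => S (fun j => rep (y j))) (fun j i => proj (w j i)) d r := by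
    intro r
    unfold decompScore
    exact Finset.sum_congr rfl fun k _ => hR.block w hw _ _
  have ho : optScore m n S w =
      optScore m n (fun y => S (fun j => rep (y j))) (fun j i => proj (w j i)) :=
    hR.optV (fun _ => n) w hw
  refine forall_congr' fun r => imp_congr_right fun _ => ?_
  rw [hd, ho]
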